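/- Let α ≥ 1 and let r′, r″ be a left pair of maximal repetitions in a word w. If the pair r′, r″ represents at least one maximal α-gapped repeat, then r″ is α-close to r′ from the right, i.e., beg(r″) − beg(r′) ≤ α·|r′|. -/

import Mathlib

variable {A : Type*}

/-- `p` is a period of the factor `w[i..j]` of the word `w` (positions are 1-based):
`1 ≤ p ≤ j - i + 1` and `w[k] = w[k+p]` whenever both positions lie in `[i, j]`. -/
def IsPeriodOf (w : ℕ → A) (i j p : ℕ) : Prop :=
  1 ≤ p ∧ p ≤ j - i + 1 ∧ ∀ k, i ≤ k → k + p ≤ j → w k = w (k + p)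

/-- The minimal period of the factor `w[i..j]`. -/
noncomputable def minPer (w : ℕ → A) (i j : ℕ) : ℕ :=
  sInf {p | IsPeriodOf w i j p}

/-- The maximality conditions for a factor `w[i..j]` of the word `w` of length `n`,
with respect to its minimal period: it cannot be extended to the left or to the right
by one letter preserving the minimal period. -/
def MaxCond (n : ℕ) (w : ℕ → A) (i j : ℕ) : Prop :=
  (1 < i → w (i - 1) ≠ w (i + minPer w i j - 1)) ∧
  (j < n → w (j + 1) ≠ w (j - minPer w i j + 1))

/-- `w[i..j]` is a maximal repetition (run) in the word `w` of length `n`. -/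
def IsMaxRepetition (n : ℕ) (w : ℕ → A) (i j : ℕ) : Prop :=
  1 ≤ i ∧ i ≤ j ∧ j ≤ n ∧ 2 * minPer w i j ≤ j - i + 1 ∧ MaxCond n w i j

/-- `w[i..j]` is a maximal subrepetition in the word `w` of length `n`:
its exponent is strictly between 1 and 2 and it satisfies the maximality conditions. -/
def IsMaxSubrepetition (n : ℕ) (w : ℕ → A) (i j : ℕ) : Prop :=
  1 ≤ i ∧ i ≤ j ∧ j ≤ n ∧ minPer w i j < j - i + 1 ∧
    j - i + 1 < 2 * minPer w i j ∧ MaxCond n w i j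

/-- A repeat in the word `w` of length `n`: a pair of equal factors
`w[b1..e1]` (left copy) and `w[b2..e2]` (right copy) with `b1 < b2`. -/
structure WordRepeat (n : ℕ) (w : ℕ → A) where
  b1 : ℕ
  e1 : ℕ
  b2 : ℕ
  e2 : ℕ
  one_le_b1 : 1 ≤ b1
  b1_le_e1 : b1 ≤ e1
  b2_le_e2 : b2 ≤ e2
  e2_le_n : e2 ≤ n
  b1_lt_b2 : b1 < b2
  len_eq : e1 - b1 = e2 - b2
  copies_eq : ∀ k, k ≤ e1 - b1 → w (b1 + k) = w (b2 + k)

namespace WordRepeat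

variable {n : ℕ} {w : ℕ → A}

/-- The period of the repeat. -/
def p (σ : WordRepeat n w) : ℕ := σ.b2 - σ.b1

/-- The length of the copies of the repeat. -/
def c (σ : WordRepeat n w) : ℕ := σ.e1 - σ.b1 + 1

/-- The repeat is maximal: its copies cannot be simultaneously extended to the left
or to the right preserving the period. (`fact σ = w[b1..e2]`.) -/
def Maximal (σ : WordRepeat n w) : Prop :=
  (1 < σ.b1 → w (σ.b1 - 1) ≠ w (σ.b2 - 1)) ∧
  (σ.e2 < n → w (σ.e1 + 1) ≠ w (σ.e2 + 1))

/-- The repeat is overlapped: its copies are overlapped factors. -/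
def Overlapped (σ : WordRepeat n w) : Prop := σ.b2 ≤ σ.e1 + 1

/-- The repeat is gapped: there is a nonempty gap between its copies. -/
def Gapped (σ : WordRepeat n w) : Prop := σ.e1 + 1 < σ.b2

/-- The repeat is `α`-gapped: it is gapped and `p(σ) ≤ α ⬝ c(σ)`. -/
def AlphaGapped (α : ℝ) (σ : WordRepeat n w) : Prop :=
  σ.Gapped ∧ (σ.p : ℝ) ≤ α * (σ.c : ℝ)

/-- `σ` is covered by `σ'`: `fact σ = w[σ.b1..σ.e2]` is contained in
`fact σ' = w[σ'.b1..σ'.e2]` and `p(σ') < p(σ)`. -/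
def CoveredBy (σ σ' : WordRepeat n w) : Prop :=
  σ'.b1 ≤ σ.b1 ∧ σ.e2 ≤ σ'.e2 ∧ σ'.p < σ.p

end WordRepeat

/-- `σ` is the principal repeat of some maximal repetition of `w`
(a reprincipal repeat). -/
def IsPrincipalOfMaxRepetition {n : ℕ} {w : ℕ → A} (σ : WordRepeat n w) : Prop :=
  ∃ i j, IsMaxRepetition n w i j ∧ σ.b1 = i ∧ σ.e1 = j - minPer w i j ∧
    σ.b2 = i + minPer w i j ∧ σ.e2 = j

/-- `σ` is principal: it is the principal repeat of some maximal repetition or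
maximal subrepetition of `w`. -/
def IsPrincipal {n : ℕ} {w : ℕ → A} (σ : WordRepeat n w) : Prop :=
  ∃ i j, (IsMaxRepetition n w i j ∨ IsMaxSubrepetition n w i j) ∧ σ.b1 = i ∧
    σ.e1 = j - minPer w i j ∧ σ.b2 = i + minPer w i j ∧ σ.e2 = j

/-- `σ` is a periodic repeat: its copies are repetitions whose minimal period
is at most `c(σ)/3`. -/
def IsPeriodicRepeat {n : ℕ} {w : ℕ → A} (σ : WordRepeat n w) : Prop :=
  3 * minPer w σ.b1 σ.e1 ≤ σ.c

/-- The periodic repeat `σ` is represented by the maximal repetition `w[i..j]`: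
both copies of `σ` extend (preserving their minimal period) to `w[i..j]`;
equivalently, `w[i..j]` is a maximal repetition whose minimal period equals the
minimal period of the copies of `σ` and which contains both copies of `σ`. -/
def RepresentedBy {n : ℕ} {w : ℕ → A} (σ : WordRepeat n w) (i j : ℕ) : Prop :=
  IsPeriodicRepeat σ ∧ IsMaxRepetition n w i j ∧
  minPer w i j = minPer w σ.b1 σ.e1 ∧ i ≤ σ.b1 ∧ σ.e2 ≤ j

/-- The periodic repeat `σ` is represented by the pair of distinct maximal repetitions
`w[i1..j1]`, `w[i2..j2]`: the left copy of `σ` extends to `w[i1..j1]`, the right copy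
extends to `w[i2..j2]`, the two repetitions being distinct (`σ` is birepresented). -/
def RepresentedByPair {n : ℕ} {w : ℕ → A} (σ : WordRepeat n w)
    (i1 j1 i2 j2 : ℕ) : Prop :=
  IsPeriodicRepeat σ ∧ IsMaxRepetition n w i1 j1 ∧ IsMaxRepetition n w i2 j2 ∧
  minPer w i1 j1 = minPer w σ.b1 σ.e1 ∧ minPer w i2 j2 = minPer w σ.b1 σ.e1 ∧
  i1 ≤ σ.b1 ∧ σ.e1 ≤ j1 ∧ i2 ≤ σ.b2 ∧ σ.e2 ≤ j2 ∧ ¬(i1 = i2 ∧ j1 = j2)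


theorem isPeriodOf_length (w : ℕ → A) (i j : ℕ) : IsPeriodOf w i j (j - i + 1) :=
  ⟨by omega, le_rfl, fun k hi hj => by omega⟩

theorem isPeriodOf_minPer (w : ℕ → A) (i j : ℕ) : IsPeriodOf w i j (minPer w i j) :=
  Nat.sInf_mem (s := {p | IsPeriodOf w i j p}) ⟨_, isPeriodOf_length w i j⟩

/-- A maximal periodic repeat represented by a pair of maximal repetitions has a copy that
starts together with its repetition. -/
theorem RepresentedByPair.begins_eq {n : ℕ} {w : ℕ → A} {σ : WordRepeat n w}
    {i1 j1 i2 j2 : ℕ} (hrep : RepresentedByPair σ i1 j1 i2 j2) (hmax : σ.Maximal) :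
    σ.b1 = i1 ∨ σ.b2 = i2 := by
  obtain ⟨hper, hr1, -, hp1, hp2, hb1, he1, hb2, he2, -⟩ := hrep
  by_contra! hne
  obtain ⟨hne1, hne2⟩ := hne
  have hi1 := hr1.1
  obtain ⟨hpos, -, hk1⟩ := hp1 ▸ isPeriodOf_minPer w i1 j1
  obtain ⟨-, -, hk2⟩ := hp2 ▸ isPeriodOf_minPer w i2 j2
  have hlen := σ.len_eq
  have hle1 := σ.b1_le_e1
  have hle2 := σ.b2_le_e2
  unfold IsPeriodicRepeat WordRepeat.c at hper
  generalize minPer w σ.b1 σ.e1 = p at *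
  refine hmax.1 (by omega) ?_
  have hcopy := σ.copies_eq (p - 1) (by omega)
  rw [hk1 (σ.b1 - 1) (by omega) (by omega), hk2 (σ.b2 - 1) (by omega) (by omega),
    show σ.b1 - 1 + p = σ.b1 + (p - 1) by omega, show σ.b2 - 1 + p = σ.b2 + (p - 1) by omega,
    hcopy]

/-- If a left pair `w[i1..j1]`, `w[i2..j2]` of maximal repetitions represents at least
one maximal `α`-gapped repeat, then `w[i2..j2]` is `α`-close to `w[i1..j1]` from the
right, i.e. `i2 - i1 ≤ α ⬝ (j1 - i1 + 1)`. -/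
theorem alpha_close_of_represents_alpha_gapped {A : Type*} (α : ℝ) (hα : 1 ≤ α)
    (n : ℕ) (w : ℕ → A) (i1 j1 i2 j2 : ℕ)
    (hleft : j1 - i1 ≤ j2 - i2)
    (σ : WordRepeat n w) (hσmax : σ.Maximal) (hσgap : σ.AlphaGapped α)
    (hrep : RepresentedByPair σ i1 j1 i2 j2) :
    (i2 : ℝ) - (i1 : ℝ) ≤ α * ((j1 : ℝ) - (i1 : ℝ) + 1) := by
  have hbegin := hrep.begins_eq hσmax
  obtain ⟨-, -, -, -, -, hb1, he1, hb2, -, -⟩ := hrep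
  have hp : (σ.p : ℝ) = σ.b2 - σ.b1 := Nat.cast_sub σ.b1_lt_b2.le
  have hc : (σ.c : ℝ) = σ.e1 - σ.b1 + 1 := by
    simp [WordRepeat.c, Nat.cast_sub σ.b1_le_e1]
  have hgap := hσgap.2
  rw [hp, hc] at hgap
  have hb1' : (i1 : ℝ) ≤ σ.b1 := mod_cast hb1
  have he1' : (σ.e1 : ℝ) ≤ j1 := mod_cast he1
  have hb2' : (i2 : ℝ) ≤ σ.b2 := mod_cast hb2
  have hright : α * σ.e1 ≤ α * j1 := by gcongr
  rcases hbegin with h | h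
  · rw [h] at hgap
    linarith
  · have hshift : (σ.b1 : ℝ) - i1 ≤ α * (σ.b1 - i1) :=
      le_mul_of_one_le_left (sub_nonneg.2 hb1') hα
    linarith
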